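/- arXiv:1711.02048 — 7 statements merged into one kernel-verified Lean document; each statement's English description precedes it below -/
import Mathlib

section
/- Under Assumptions M3 and M4 and assuming P(C1 = 1, C0 = 0) > 0, the intention-to-treat estimand on enrollment satisfies ITT_D = E[D1 − D0 | C1 = 1, C0 = 0] · P(C1 = 1, C0 = 0). -/
open MeasureTheory ProbabilityTheory

theorem aux_cond_integral {Ω : Type*} [MeasurableSpace Ω] (P : Measure Ω) (s : Set Ω)
    (f : Ω → ℝ) : ∫ ω, f ω ∂(P[|s]) = (P s).toReal⁻¹ * ∫ ω in s, f ω ∂P := by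
  rw [ProbabilityTheory.cond, integral_smul_measure, ENNReal.toReal_inv, smul_eq_mul]

theorem aux_indep {Ω : Type*} [MeasurableSpace Ω] (P : Measure Ω) [IsProbabilityMeasure P]
    (g D Z : Ω → ℝ) (hZm : Measurable Z) (hg : Measurable g) (h : IndepFun g Z P) (z : ℝ)
    (hz : P {ω | Z ω = z} ≠ 0) (hD : ∀ ω, Z ω = z → D ω = g ω) :
    ∫ ω, D ω ∂(P[|{ω | Z ω = z}]) = ∫ ω, g ω ∂P := by
  have hs : MeasurableSet {ω | Z ω = z} := hZm (measurableSet_singleton z)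
  have hm : Measurable (Set.indicator {z} (fun _ : ℝ => (1 : ℝ))) :=
    measurable_const.indicator (measurableSet_singleton z)
  rw [aux_cond_integral, setIntegral_congr_fun hs (fun ω hω => hD ω hω), ← integral_indicator hs]
  have h2 : IndepFun g (fun ω => Set.indicator {z} (fun _ : ℝ => (1 : ℝ)) (Z ω)) P :=
    h.comp measurable_id hm
  have h3 := h2.integral_fun_mul_eq_mul_integral hg.aestronglyMeasurable
    (hm.comp hZm).aestronglyMeasurable
  have h4 : (fun ω => Set.indicator {z} (fun _ : ℝ => (1 : ℝ)) (Z ω))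
      = Set.indicator {ω | Z ω = z} (fun _ => (1 : ℝ)) := by
    ext ω; simp [Set.indicator]
  have h5 : (fun ω => g ω * Set.indicator {z} (fun _ : ℝ => (1 : ℝ)) (Z ω))
      = Set.indicator {ω | Z ω = z} g := by
    ext ω; simp [Set.indicator]
  rw [h5, h4, integral_indicator hs] at h3
  rw [integral_indicator hs, h3]
  have : (P {ω | Z ω = z}).toReal ≠ 0 := ENNReal.toReal_ne_zero.2 ⟨hz, measure_ne_top _ _⟩
  rw [integral_indicator_const _ hs, smul_eq_mul, mul_one, Measure.real]
  field_simp

/-- Under Assumptions M3 (independence of the potential variables and `Z`) and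
M4 (`C1 = 1` a.s.), and assuming `P(C1 = 1, C0 = 0) > 0`, the intention-to-treat
estimand on enrollment satisfies
`ITT_D = E[D1 − D0 | C1 = 1, C0 = 0] ⬝ P(C1 = 1, C0 = 0)`. -/
theorem itt_D_local
    {Ω : Type*} [MeasurableSpace Ω] (P : Measure Ω) [IsProbabilityMeasure P]
    (Z C0 C1 D0 D1 Y0 Y1 : Ω → ℝ)
    (hZm : Measurable Z) (hC0m : Measurable C0) (hC1m : Measurable C1)
    (hD0m : Measurable D0) (hD1m : Measurable D1)
    (hY0m : Measurable Y0) (hY1m : Measurable Y1)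
    (hZ01 : ∀ ω, Z ω = 0 ∨ Z ω = 1)
    (hC001 : ∀ ω, C0 ω = 0 ∨ C0 ω = 1)
    (hC101 : ∀ ω, C1 ω = 0 ∨ C1 ω = 1)
    (hD001 : ∀ ω, D0 ω = 0 ∨ D0 ω = 1)
    (hD101 : ∀ ω, D1 ω = 0 ∨ D1 ω = 1)
    (hY0i : Integrable Y0 P) (hY1i : Integrable Y1 P)
    (C D Y : Ω → ℝ)
    (hC : ∀ ω, C ω = C1 ω * Z ω + C0 ω * (1 - Z ω))
    (hD : ∀ ω, D ω = D1 ω * C ω + D0 ω * (1 - C ω))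
    (hY : ∀ ω, Y ω = Y1 ω * C ω + Y0 ω * (1 - C ω))
    (hZpos : 0 < P {ω | Z ω = 1}) (hZlt : P {ω | Z ω = 1} < 1)
    -- Assumption M3
    (hM3 : IndepFun (fun ω => (Y0 ω, Y1 ω, D0 ω, D1 ω, C0 ω, C1 ω)) Z P)
    -- Assumption M4
    (hM4 : ∀ᵐ ω ∂P, C1 ω = 1)
    (hcomp : 0 < P {ω | C1 ω = 1 ∧ C0 ω = 0}) :
    (∫ ω, D ω ∂(P[|{ω | Z ω = 1}])) - (∫ ω, D ω ∂(P[|{ω | Z ω = 0}]))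
      = (∫ ω, (D1 ω - D0 ω) ∂(P[|{ω | C1 ω = 1 ∧ C0 ω = 0}]))
          * (P {ω | C1 ω = 1 ∧ C0 ω = 0}).toReal := by
  have hz0 : P {ω | Z ω = 0} ≠ 0 := by
    intro h0
    have hs : MeasurableSet {ω | Z ω = 1} := hZm (measurableSet_singleton 1)
    have hc : {ω | Z ω = 1}ᶜ = {ω | Z ω = 0} := by
      ext ω; rcases hZ01 ω with h | h <;> simp [h]
    have := (prob_compl_eq_zero_iff hs (μ := P)).1 (by rw [hc]; exact h0)
    exact hZlt.ne this
  have i1 : IndepFun (fun ω => D1 ω * C1 ω + D0 ω * (1 - C1 ω)) Z P :=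
    hM3.comp (φ := fun x : ℝ × ℝ × ℝ × ℝ × ℝ × ℝ =>
      x.2.2.2.1 * x.2.2.2.2.2 + x.2.2.1 * (1 - x.2.2.2.2.2)) (ψ := id)
      (by fun_prop) measurable_id
  have i0 : IndepFun (fun ω => D1 ω * C0 ω + D0 ω * (1 - C0 ω)) Z P :=
    hM3.comp (φ := fun x : ℝ × ℝ × ℝ × ℝ × ℝ × ℝ =>
      x.2.2.2.1 * x.2.2.2.2.1 + x.2.2.1 * (1 - x.2.2.2.2.1)) (ψ := id)
      (by fun_prop) measurable_id
  rw [aux_indep P _ D Z hZm (by fun_prop) i1 1 hZpos.ne'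
      (fun ω h => by simp [hD, hC, h]),
    aux_indep P _ D Z hZm (by fun_prop) i0 0 hz0 (fun ω h => by simp [hD, hC, h])]
  have hS : MeasurableSet {ω | C1 ω = 1 ∧ C0 ω = 0} :=
    (hC1m (measurableSet_singleton 1)).inter (hC0m (measurableSet_singleton 0))
  have hne : (P {ω | C1 ω = 1 ∧ C0 ω = 0}).toReal ≠ 0 :=
    ENNReal.toReal_ne_zero.2 ⟨hcomp.ne', measure_ne_top _ _⟩
  rw [aux_cond_integral, mul_right_comm, inv_mul_cancel₀ hne, one_mul,
    ← integral_indicator hS, ← integral_sub]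
  · apply integral_congr_ae
    filter_upwards [hM4] with ω h1
    rcases hC001 ω with h | h <;> simp [Set.indicator, h, h1]
  · refine Integrable.of_bound (by fun_prop) 1 (Filter.Eventually.of_forall fun ω => ?_)
    rcases hC101 ω with h | h <;> rcases hD001 ω with h' | h' <;>
      rcases hD101 ω with h'' | h'' <;> simp [h, h', h'']
  · refine Integrable.of_bound (by fun_prop) 1 (Filter.Eventually.of_forall fun ω => ?_)
    rcases hC001 ω with h | h <;> rcases hD001 ω with h' | h' <;>
      rcases hD101 ω with h'' | h'' <;> simp [h, h', h'']
end

section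
/- Under Assumptions M3 and M4 and assuming P(C1 = 1, C0 = 0) > 0, the intention-to-treat estimand on outcomes satisfies ITT_Y = E[Y1 − Y0 | C1 = 1, C0 = 0] · P(C1 = 1, C0 = 0). -/
open MeasureTheory ProbabilityTheory

lemma cond_int_aux {Ω : Type*} [MeasurableSpace Ω] (P : Measure Ω) [IsProbabilityMeasure P]
    (s : Set Ω) (hs : MeasurableSet s) (f : Ω → ℝ) :
    ∫ ω, f ω ∂(P[|s]) = (P s).toReal⁻¹ * ∫ ω in s, f ω ∂P := by
  rw [ProbabilityTheory.cond, integral_smul_measure, ENNReal.toReal_inv, smul_eq_mul]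

lemma cond_indep_aux {Ω : Type*} [MeasurableSpace Ω] (P : Measure Ω) [IsProbabilityMeasure P]
    (X Z W : Ω → ℝ) (hX : Measurable X) (hZ : Measurable Z) (h : IndepFun X Z P) (z : ℝ)
    (hz : P {ω | Z ω = z} ≠ 0) (hW : ∀ ω, Z ω = z → W ω = X ω) :
    ∫ ω, W ω ∂(P[|{ω | Z ω = z}]) = ∫ ω, X ω ∂P := by
  have hs : MeasurableSet {ω | Z ω = z} := hZ (measurableSet_singleton z)
  rw [cond_int_aux P _ hs, setIntegral_congr_fun hs (fun ω hω => hW ω hω), ← integral_indicator hs]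
  have hg : Measurable (Set.indicator {z} (fun _ : ℝ => (1 : ℝ))) :=
    measurable_const.indicator (measurableSet_singleton z)
  have h2 := (h.comp measurable_id hg).integral_fun_mul_eq_mul_integral
    hX.aestronglyMeasurable (hg.comp hZ).aestronglyMeasurable
  have e1 : (fun ω => (id ∘ X) ω * (Set.indicator {z} (fun _ : ℝ => (1 : ℝ)) ∘ Z) ω)
      = Set.indicator {ω | Z ω = z} X := by
    ext ω
    by_cases hω : Z ω = z <;> simp [hω]
  have e2 : (Set.indicator {z} (fun _ : ℝ => (1 : ℝ)) ∘ Z)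
      = Set.indicator {ω | Z ω = z} (fun _ => (1 : ℝ)) := by
    ext ω
    by_cases hω : Z ω = z <;> simp [hω]
  rw [e1, e2, integral_indicator hs (f := fun _ => (1 : ℝ))] at h2
  have h3 : (P {ω | Z ω = z}).toReal ≠ 0 := ENNReal.toReal_ne_zero.2 ⟨hz, measure_ne_top _ _⟩
  simp only [integral_const, smul_eq_mul, mul_one, Measure.real, Measure.restrict_apply_univ,
    Function.id_comp] at h2
  have h4 : ∫ ω, Set.indicator {ω | Z ω = z} (fun ω => X ω) ω ∂P
      = (∫ ω, X ω ∂P) * (P {ω | Z ω = z}).toReal := h2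
  rw [h4]
  field_simp

/-- Under Assumptions M3 and M4, and assuming `P(C1 = 1, C0 = 0) > 0`, the
intention-to-treat estimand on outcomes satisfies
`ITT_Y = E[Y1 − Y0 | C1 = 1, C0 = 0] ⬝ P(C1 = 1, C0 = 0)`. -/
theorem itt_Y_local
    {Ω : Type*} [MeasurableSpace Ω] (P : Measure Ω) [IsProbabilityMeasure P]
    (Z C0 C1 D0 D1 Y0 Y1 : Ω → ℝ)
    (hZm : Measurable Z) (hC0m : Measurable C0) (hC1m : Measurable C1)
    (hD0m : Measurable D0) (hD1m : Measurable D1)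
    (hY0m : Measurable Y0) (hY1m : Measurable Y1)
    (hZ01 : ∀ ω, Z ω = 0 ∨ Z ω = 1)
    (hC001 : ∀ ω, C0 ω = 0 ∨ C0 ω = 1)
    (hC101 : ∀ ω, C1 ω = 0 ∨ C1 ω = 1)
    (hD001 : ∀ ω, D0 ω = 0 ∨ D0 ω = 1)
    (hD101 : ∀ ω, D1 ω = 0 ∨ D1 ω = 1)
    (hY0i : Integrable Y0 P) (hY1i : Integrable Y1 P)
    (C D Y : Ω → ℝ)
    (hC : ∀ ω, C ω = C1 ω * Z ω + C0 ω * (1 - Z ω))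
    (hD : ∀ ω, D ω = D1 ω * C ω + D0 ω * (1 - C ω))
    (hY : ∀ ω, Y ω = Y1 ω * C ω + Y0 ω * (1 - C ω))
    (hZpos : 0 < P {ω | Z ω = 1}) (hZlt : P {ω | Z ω = 1} < 1)
    -- Assumption M3
    (hM3 : IndepFun (fun ω => (Y0 ω, Y1 ω, D0 ω, D1 ω, C0 ω, C1 ω)) Z P)
    -- Assumption M4
    (hM4 : ∀ᵐ ω ∂P, C1 ω = 1)
    (hcomp : 0 < P {ω | C1 ω = 1 ∧ C0 ω = 0}) :
    (∫ ω, Y ω ∂(P[|{ω | Z ω = 1}])) - (∫ ω, Y ω ∂(P[|{ω | Z ω = 0}]))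
      = (∫ ω, (Y1 ω - Y0 ω) ∂(P[|{ω | C1 ω = 1 ∧ C0 ω = 0}]))
          * (P {ω | C1 ω = 1 ∧ C0 ω = 0}).toReal := by
  have hZ0 : P {ω | Z ω = 0} ≠ 0 := by
    intro h0
    have hu : (Set.univ : Set Ω) = {ω | Z ω = 0} ∪ {ω | Z ω = 1} := by
      ext ω
      simpa using hZ01 ω
    have h1 := measure_union_le (μ := P) {ω | Z ω = 0} {ω | Z ω = 1}
    rw [← hu, h0, zero_add, measure_univ] at h1
    exact absurd hZlt (not_lt.2 h1)
  have hbd : ∀ (c f : Ω → ℝ), Measurable c → (∀ ω, c ω = 0 ∨ c ω = 1) → Integrable f P →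
      Integrable (fun ω => f ω * c ω) P := by
    intro c f hc h01 hf
    refine hf.mul_bdd (c := 1) hc.aestronglyMeasurable (ae_of_all _ fun ω => ?_)
    rcases h01 ω with h | h <;> simp [h]
  have hint : ∀ c : Ω → ℝ, Measurable c → (∀ ω, c ω = 0 ∨ c ω = 1) →
      Integrable (fun ω => Y1 ω * c ω + Y0 ω * (1 - c ω)) P := by
    intro c hc h01
    refine (hbd c Y1 hc h01 hY1i).add (hbd (fun ω => 1 - c ω) Y0 (by fun_prop) ?_ hY0i)
    intro ω
    rcases h01 ω with h | h <;> simp [h]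
  have i1 : IndepFun (fun ω => Y1 ω * C1 ω + Y0 ω * (1 - C1 ω)) Z P :=
    hM3.comp (φ := fun v : ℝ × ℝ × ℝ × ℝ × ℝ × ℝ =>
      v.2.1 * v.2.2.2.2.2 + v.1 * (1 - v.2.2.2.2.2)) (ψ := id) (by fun_prop) measurable_id
  have i0 : IndepFun (fun ω => Y1 ω * C0 ω + Y0 ω * (1 - C0 ω)) Z P :=
    hM3.comp (φ := fun v : ℝ × ℝ × ℝ × ℝ × ℝ × ℝ =>
      v.2.1 * v.2.2.2.2.1 + v.1 * (1 - v.2.2.2.2.1)) (ψ := id) (by fun_prop) measurable_id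
  have hs : MeasurableSet {ω | C1 ω = 1 ∧ C0 ω = 0} :=
    (hC1m (measurableSet_singleton 1)).inter (hC0m (measurableSet_singleton 0))
  have hne : (P {ω | C1 ω = 1 ∧ C0 ω = 0}).toReal ≠ 0 :=
    ENNReal.toReal_ne_zero.2 ⟨hcomp.ne', measure_ne_top _ _⟩
  rw [cond_indep_aux P _ Z Y (by fun_prop) hZm i1 1 hZpos.ne' (fun ω h => by simp [hY, hC, h]),
    cond_indep_aux P _ Z Y (by fun_prop) hZm i0 0 hZ0 (fun ω h => by simp [hY, hC, h]),
    cond_int_aux P _ hs, ← integral_sub (hint C1 hC1m hC101) (hint C0 hC0m hC001),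
    mul_comm, mul_inv_cancel_left₀ hne, ← integral_indicator hs]
  refine integral_congr_ae ?_
  filter_upwards [hM4] with ω h1
  rcases hC001 ω with h | h <;> simp [h, h1]
end

section
/- Under Assumptions M1, M2, M3 and M4 and assuming P(D1 = 1, C1 = 1, C0 = 0) > 0, the instrumental variable estimand satisfies IV = ITT_Y / ITT_D = E[Y1 − Y0 | D1 = 1, C1 = 1, C0 = 0]; in particular ITT_D = P(D1 = 1, C1 = 1, C0 = 0) > 0 so the ratio is well defined. -/
open MeasureTheory ProbabilityTheory

theorem cond_integral_aux {Ω : Type*} [MeasurableSpace Ω] (P : Measure Ω) [IsProbabilityMeasure P]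
    (X Z W : Ω → ℝ) (z : ℝ) (hZm : Measurable Z) (hX : Measurable X)
    (hi : IndepFun X Z P) (hz : P {ω | Z ω = z} ≠ 0)
    (hW : ∀ᵐ ω ∂P, Z ω = z → W ω = X ω) :
    ∫ ω, W ω ∂(P[|{ω | Z ω = z}]) = ∫ ω, X ω ∂P := by
  have hs : MeasurableSet {ω | Z ω = z} := hZm (measurableSet_singleton z)
  have hg : Measurable (({z} : Set ℝ).indicator (fun _ => (1 : ℝ))) :=
    measurable_const.indicator (measurableSet_singleton z)
  have h1 := (hi.comp measurable_id hg).integral_fun_mul_eq_mul_integral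
    hX.aestronglyMeasurable (hg.comp hZm).aestronglyMeasurable
  have h2 : ∫ ω, (({z} : Set ℝ).indicator (fun _ => (1 : ℝ)) ∘ Z) ω ∂P
      = P.real {ω | Z ω = z} := by
    rw [← integral_indicator_one hs]
    congr 1
  have h3 : ∫ ω in {ω | Z ω = z}, W ω ∂P = (∫ ω, X ω ∂P) * P.real {ω | Z ω = z} := by
    rw [← h2, ← integral_indicator hs]
    refine Eq.trans ?_ h1
    apply integral_congr_ae
    filter_upwards [hW] with ω h
    by_cases hω : Z ω = z
    · simp [Set.indicator, hω, h hω]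
    · simp [Set.indicator, hω]
  have hr : P.real {ω | Z ω = z} ≠ 0 := by
    simp [Measure.real, ENNReal.toReal_eq_zero_iff, hz]
  rw [ProbabilityTheory.cond, integral_smul_measure, h3, ENNReal.toReal_inv, smul_eq_mul]
  change (P.real _)⁻¹ * _ = _
  field_simp

/-- Under Assumptions M1–M4, and assuming `P(D1 = 1, C1 = 1, C0 = 0) > 0`, the
IV estimand satisfies `IV = ITT_Y / ITT_D = E[Y1 − Y0 | D1 = 1, C1 = 1, C0 = 0]`;
in particular `ITT_D = P(D1 = 1, C1 = 1, C0 = 0) > 0`, so the ratio is well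
defined. -/
theorem iv_local
    {Ω : Type*} [MeasurableSpace Ω] (P : Measure Ω) [IsProbabilityMeasure P]
    (Z C0 C1 D0 D1 Y0 Y1 : Ω → ℝ)
    (hZm : Measurable Z) (hC0m : Measurable C0) (hC1m : Measurable C1)
    (hD0m : Measurable D0) (hD1m : Measurable D1)
    (hY0m : Measurable Y0) (hY1m : Measurable Y1)
    (hZ01 : ∀ ω, Z ω = 0 ∨ Z ω = 1)
    (hC001 : ∀ ω, C0 ω = 0 ∨ C0 ω = 1)
    (hC101 : ∀ ω, C1 ω = 0 ∨ C1 ω = 1)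
    (hD001 : ∀ ω, D0 ω = 0 ∨ D0 ω = 1)
    (hD101 : ∀ ω, D1 ω = 0 ∨ D1 ω = 1)
    (hY0i : Integrable Y0 P) (hY1i : Integrable Y1 P)
    (C D Y : Ω → ℝ)
    (hC : ∀ ω, C ω = C1 ω * Z ω + C0 ω * (1 - Z ω))
    (hD : ∀ ω, D ω = D1 ω * C ω + D0 ω * (1 - C ω))
    (hY : ∀ ω, Y ω = Y1 ω * C ω + Y0 ω * (1 - C ω))
    (hZpos : 0 < P {ω | Z ω = 1}) (hZlt : P {ω | Z ω = 1} < 1)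
    -- Assumption M1
    (hM1 : ∀ᵐ ω ∂P, D0 ω = 0)
    -- Assumption M2
    (hM2 : ∀ᵐ ω ∂P, D0 ω = D1 ω → Y0 ω = Y1 ω)
    -- Assumption M3
    (hM3 : IndepFun (fun ω => (Y0 ω, Y1 ω, D0 ω, D1 ω, C0 ω, C1 ω)) Z P)
    -- Assumption M4
    (hM4 : ∀ᵐ ω ∂P, C1 ω = 1)
    (hcomp : 0 < P {ω | D1 ω = 1 ∧ C1 ω = 1 ∧ C0 ω = 0}) :
    (∫ ω, D ω ∂(P[|{ω | Z ω = 1}])) - (∫ ω, D ω ∂(P[|{ω | Z ω = 0}]))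
      = (P {ω | D1 ω = 1 ∧ C1 ω = 1 ∧ C0 ω = 0}).toReal
    ∧ 0 < (∫ ω, D ω ∂(P[|{ω | Z ω = 1}])) - (∫ ω, D ω ∂(P[|{ω | Z ω = 0}]))
    ∧ ((∫ ω, Y ω ∂(P[|{ω | Z ω = 1}])) - (∫ ω, Y ω ∂(P[|{ω | Z ω = 0}])))
        / ((∫ ω, D ω ∂(P[|{ω | Z ω = 1}])) - (∫ ω, D ω ∂(P[|{ω | Z ω = 0}])))
      = ∫ ω, (Y1 ω - Y0 ω) ∂(P[|{ω | D1 ω = 1 ∧ C1 ω = 1 ∧ C0 ω = 0}]) := by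
  have hZ0 : P {ω | Z ω = 0} ≠ 0 := by
    intro h0
    have : ∀ᵐ ω ∂P, Z ω = 1 := by
      have h0' : ∀ᵐ ω ∂P, ¬ Z ω = 0 := by
        rw [ae_iff]; simpa using h0
      filter_upwards [h0'] with ω h
      exact (hZ01 ω).resolve_left h
    have h1 : P {ω | Z ω = 1} = 1 := by
      refine (prob_compl_eq_zero_iff (hZm (measurableSet_singleton 1))).1 ?_
      exact this
    exact absurd h1 hZlt.ne
  have hA : MeasurableSet {ω | D1 ω = 1 ∧ C1 ω = 1 ∧ C0 ω = 0} :=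
    (hD1m (measurableSet_singleton 1)).inter
      ((hC1m (measurableSet_singleton 1)).inter (hC0m (measurableSet_singleton 0)))
  have hC0b : ∀ᵐ ω ∂P, ‖C0 ω‖ ≤ 1 := by
    filter_upwards with ω
    rcases hC001 ω with h | h <;> simp [h]
  have hC0b' : ∀ᵐ ω ∂P, ‖1 - C0 ω‖ ≤ 1 := by
    filter_upwards with ω
    rcases hC001 ω with h | h <;> simp [h]
  have hD1i : Integrable D1 P := by
    refine Integrable.of_bound hD1m.aestronglyMeasurable 1 ?_
    filter_upwards with ω
    rcases hD101 ω with h | h <;> simp [h]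
  have hD1C : Integrable (fun ω => D1 ω * C0 ω) P :=
    hD1i.mul_bdd hC0m.aestronglyMeasurable hC0b
  have hYC : Integrable (fun ω => Y1 ω * C0 ω + Y0 ω * (1 - C0 ω)) P :=
    (hY1i.mul_bdd hC0m.aestronglyMeasurable hC0b).add
      (hY0i.mul_bdd (measurable_const.sub hC0m).aestronglyMeasurable hC0b')
  have i1 : IndepFun D1 Z P :=
    hM3.comp (φ := fun p : ℝ × ℝ × ℝ × ℝ × ℝ × ℝ => p.2.2.2.1) (by fun_prop) measurable_id
  have i2 : IndepFun (fun ω => D1 ω * C0 ω) Z P :=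
    hM3.comp (φ := fun p : ℝ × ℝ × ℝ × ℝ × ℝ × ℝ => p.2.2.2.1 * p.2.2.2.2.1)
      (by fun_prop) measurable_id
  have i3 : IndepFun Y1 Z P :=
    hM3.comp (φ := fun p : ℝ × ℝ × ℝ × ℝ × ℝ × ℝ => p.2.1) (by fun_prop) measurable_id
  have i4 : IndepFun (fun ω => Y1 ω * C0 ω + Y0 ω * (1 - C0 ω)) Z P :=
    hM3.comp (φ := fun p : ℝ × ℝ × ℝ × ℝ × ℝ × ℝ =>
      p.2.1 * p.2.2.2.2.1 + p.1 * (1 - p.2.2.2.2.1)) (by fun_prop) measurable_id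
  have e1 : ∫ ω, D ω ∂(P[|{ω | Z ω = 1}]) = ∫ ω, D1 ω ∂P := by
    refine cond_integral_aux P D1 Z D 1 hZm hD1m i1 hZpos.ne' ?_
    filter_upwards [hM4] with ω h4 hz
    simp [hD, hC, h4, hz]
  have e2 : ∫ ω, D ω ∂(P[|{ω | Z ω = 0}]) = ∫ ω, D1 ω * C0 ω ∂P := by
    refine cond_integral_aux P _ Z D 0 hZm (by fun_prop) i2 hZ0 ?_
    filter_upwards [hM1] with ω h1 hz
    simp [hD, hC, h1, hz]
  have e3 : ∫ ω, Y ω ∂(P[|{ω | Z ω = 1}]) = ∫ ω, Y1 ω ∂P := by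
    refine cond_integral_aux P Y1 Z Y 1 hZm hY1m i3 hZpos.ne' ?_
    filter_upwards [hM4] with ω h4 hz
    simp [hY, hC, h4, hz]
  have e4 : ∫ ω, Y ω ∂(P[|{ω | Z ω = 0}])
      = ∫ ω, (Y1 ω * C0 ω + Y0 ω * (1 - C0 ω)) ∂P := by
    refine cond_integral_aux P _ Z Y 0 hZm (by fun_prop) i4 hZ0 ?_
    filter_upwards with ω hz
    simp [hY, hC, hz]
  have hpos : 0 < (P {ω | D1 ω = 1 ∧ C1 ω = 1 ∧ C0 ω = 0}).toReal :=
    ENNReal.toReal_pos hcomp.ne' (measure_ne_top _ _)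
  have hITT : (∫ ω, D ω ∂(P[|{ω | Z ω = 1}])) - (∫ ω, D ω ∂(P[|{ω | Z ω = 0}]))
      = (P {ω | D1 ω = 1 ∧ C1 ω = 1 ∧ C0 ω = 0}).toReal := by
    rw [e1, e2, ← integral_sub hD1i hD1C]
    refine Eq.trans ?_ (integral_indicator_one hA)
    apply integral_congr_ae
    filter_upwards [hM4] with ω h4
    rcases hD101 ω with h | h <;> rcases hC001 ω with h' | h' <;>
      simp [Set.indicator, h, h', h4]
  refine ⟨hITT, hITT ▸ hpos, ?_⟩
  have hY' : (∫ ω, Y ω ∂(P[|{ω | Z ω = 1}])) - (∫ ω, Y ω ∂(P[|{ω | Z ω = 0}]))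
      = ∫ ω in {ω | D1 ω = 1 ∧ C1 ω = 1 ∧ C0 ω = 0}, (Y1 ω - Y0 ω) ∂P := by
    rw [e3, e4, ← integral_sub hY1i hYC, ← integral_indicator hA]
    apply integral_congr_ae
    filter_upwards [hM4, hM1, hM2] with ω h4 h1 h2
    rcases hD101 ω with h | h <;> rcases hC001 ω with h' | h'
    · simp [Set.indicator, h, h', h4, h2 (h1.trans h.symm)]
    all_goals simp [Set.indicator, h, h', h4]
  rw [hITT, hY', ProbabilityTheory.cond, integral_smul_measure, ENNReal.toReal_inv, smul_eq_mul,
    div_eq_inv_mul]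
end

section
/- Under Assumptions M1, M2, M3 and M4, the intention-to-treat estimand on outcomes satisfies ITT_Y = E[(Y1 − Y0) · 1{D1 = 1, C1 = 1, C0 = 0}], i.e., only compliers who would enroll when given access contribute to the ITT on outcomes. -/
open MeasureTheory ProbabilityTheory

lemma cond_int_aux_s5 {Ω E : Type*} [MeasurableSpace Ω] [MeasurableSpace E] (P : Measure Ω)
    [IsProbabilityMeasure P] (V : Ω → E) (Z : Ω → ℝ) (hV : Measurable V) (hZ : Measurable Z)
    (h : IndepFun V Z P) (g : E → ℝ) (hg : Measurable g) (z : ℝ) (hz : P {ω | Z ω = z} ≠ 0)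
    (Y : Ω → ℝ) (hY : ∀ ω, Z ω = z → Y ω = g (V ω)) :
    ∫ ω, Y ω ∂(P[|{ω | Z ω = z}]) = ∫ ω, g (V ω) ∂P := by
  have hms : MeasurableSet {ω | Z ω = z} := hZ (measurableSet_singleton z)
  have h1 : ∫ ω in {ω | Z ω = z}, Y ω ∂P = ∫ ω in {ω | Z ω = z}, g (V ω) ∂P :=
    setIntegral_congr_fun hms (fun ω hω => hY ω hω)
  have h2 : ∫ ω in {ω | Z ω = z}, g (V ω) ∂P = P.real {ω | Z ω = z} * ∫ ω, g (V ω) ∂P :=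
    Indep.setIntegral_eq_mul (m := MeasurableSpace.comap Z inferInstance) hZ.comap_le
      h.symm hV.aemeasurable ⟨{z}, measurableSet_singleton z, rfl⟩ hg.aestronglyMeasurable
  have hr : P.real {ω | Z ω = z} ≠ 0 := by
    simp [Measure.real, ENNReal.toReal_eq_zero_iff, hz]
  rw [ProbabilityTheory.cond, integral_smul_measure, h1, h2, ENNReal.toReal_inv, smul_eq_mul]
  change (P.real {ω | Z ω = z})⁻¹ * _ = _
  rw [inv_mul_cancel_left₀ hr]

/-- Under Assumptions M1–M4, the intention-to-treat estimand on outcomes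
satisfies `ITT_Y = E[(Y1 − Y0) · 1{D1 = 1, C1 = 1, C0 = 0}]`: only compliers
who would enroll when given access contribute to the ITT on outcomes. -/
theorem itt_Y_indicator
    {Ω : Type*} [MeasurableSpace Ω] (P : Measure Ω) [IsProbabilityMeasure P]
    (Z C0 C1 D0 D1 Y0 Y1 : Ω → ℝ)
    (hZm : Measurable Z) (hC0m : Measurable C0) (hC1m : Measurable C1)
    (hD0m : Measurable D0) (hD1m : Measurable D1)
    (hY0m : Measurable Y0) (hY1m : Measurable Y1)
    (hZ01 : ∀ ω, Z ω = 0 ∨ Z ω = 1)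
    (hC001 : ∀ ω, C0 ω = 0 ∨ C0 ω = 1)
    (hC101 : ∀ ω, C1 ω = 0 ∨ C1 ω = 1)
    (hD001 : ∀ ω, D0 ω = 0 ∨ D0 ω = 1)
    (hD101 : ∀ ω, D1 ω = 0 ∨ D1 ω = 1)
    (hY0i : Integrable Y0 P) (hY1i : Integrable Y1 P)
    (C D Y : Ω → ℝ)
    (hC : ∀ ω, C ω = C1 ω * Z ω + C0 ω * (1 - Z ω))
    (hD : ∀ ω, D ω = D1 ω * C ω + D0 ω * (1 - C ω))
    (hY : ∀ ω, Y ω = Y1 ω * C ω + Y0 ω * (1 - C ω))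
    (hZpos : 0 < P {ω | Z ω = 1}) (hZlt : P {ω | Z ω = 1} < 1)
    -- Assumption M1
    (hM1 : ∀ᵐ ω ∂P, D0 ω = 0)
    -- Assumption M2
    (hM2 : ∀ᵐ ω ∂P, D0 ω = D1 ω → Y0 ω = Y1 ω)
    -- Assumption M3
    (hM3 : IndepFun (fun ω => (Y0 ω, Y1 ω, D0 ω, D1 ω, C0 ω, C1 ω)) Z P)
    -- Assumption M4
    (hM4 : ∀ᵐ ω ∂P, C1 ω = 1) :
    (∫ ω, Y ω ∂(P[|{ω | Z ω = 1}])) - (∫ ω, Y ω ∂(P[|{ω | Z ω = 0}]))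
      = ∫ ω, ({ω | D1 ω = 1 ∧ C1 ω = 1 ∧ C0 ω = 0}.indicator
          (fun ω => Y1 ω - Y0 ω)) ω ∂P := by
  have hz0 : P {ω | Z ω = 0} ≠ 0 := by
    intro h0
    have hc : {ω | Z ω = 1}ᶜ = {ω | Z ω = 0} := by
      ext ω
      rcases hZ01 ω with h | h <;> simp [h]
    have hm : MeasurableSet {ω | Z ω = 1} := hZm (measurableSet_singleton 1)
    rw [← hc, prob_compl_eq_zero_iff hm] at h0
    exact hZlt.ne h0
  have hV : Measurable (fun ω => (Y0 ω, Y1 ω, D0 ω, D1 ω, C0 ω, C1 ω)) := by fun_prop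
  rw [cond_int_aux_s5 P _ Z hV hZm hM3
      (fun p => p.2.1 * p.2.2.2.2.2 + p.1 * (1 - p.2.2.2.2.2)) (by fun_prop) 1 hZpos.ne' Y
      (fun ω h => by simp [hY, hC, h]),
    cond_int_aux_s5 P _ Z hV hZm hM3
      (fun p => p.2.1 * p.2.2.2.2.1 + p.1 * (1 - p.2.2.2.2.1)) (by fun_prop) 0 hz0 Y
      (fun ω h => by simp [hY, hC, h])]
  have key : ∀ c : Ω → ℝ, Measurable c → (∀ ω, c ω = 0 ∨ c ω = 1) →
      Integrable (fun ω => Y1 ω * c ω + Y0 ω * (1 - c ω)) P := by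
    intro c hc h01
    refine Integrable.add (hY1i.mul_bdd (c := 1) hc.aestronglyMeasurable ?_)
      (hY0i.mul_bdd (c := 1) (by fun_prop) ?_)
    · exact .of_forall fun ω => by rcases h01 ω with h | h <;> simp [h]
    · exact .of_forall fun ω => by rcases h01 ω with h | h <;> simp [h]
  rw [← integral_sub (key C1 hC1m hC101) (key C0 hC0m hC001)]
  refine integral_congr_ae ?_
  filter_upwards [hM1, hM2, hM4] with ω h1 h2 h4
  rcases hD101 ω with hd | hd <;> rcases hC001 ω with hc | hc
  · simp [Set.indicator, hd, hc, h4, h2 (h1.trans hd.symm)]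
  · simp [Set.indicator, hd, hc, h4]
  · simp [Set.indicator, hd, hc, h4]
  · simp [Set.indicator, hd, hc, h4]
end

section
/- Under Assumptions M1, M3 and M4, the intention-to-treat estimand on enrollment satisfies ITT_D = P(D1 = 1, C1 = 1, C0 = 0). -/
open MeasureTheory ProbabilityTheory

theorem aux_cond_integral_s6 {Ω E : Type*} [MeasurableSpace Ω] [MeasurableSpace E] (P : Measure Ω)
    [IsProbabilityMeasure P] (V : Ω → E) (Z D : Ω → ℝ) (hV : Measurable V) (hZ : Measurable Z)
    (hI : IndepFun V Z P) (z : ℝ) (hz : P {ω | Z ω = z} ≠ 0) (S : Set E) (hS : MeasurableSet S)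
    (hD : ∀ᵐ ω ∂P, Z ω = z → D ω = (V ⁻¹' S).indicator 1 ω) :
    ∫ ω, D ω ∂(P[|{ω | Z ω = z}]) = P.real (V ⁻¹' S) := by
  have hzm : MeasurableSet {ω | Z ω = z} := hZ (measurableSet_singleton z)
  have h1 : D =ᵐ[P[|{ω | Z ω = z}]] (V ⁻¹' S).indicator 1 := by
    have h2 : ∀ᵐ ω ∂(P[|{ω | Z ω = z}]), Z ω = z := ae_cond_mem hzm
    have h3 := (cond_absolutelyContinuous (μ := P) (s := {ω | Z ω = z})).ae_le hD
    filter_upwards [h2, h3] with ω a b using b a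
  rw [integral_congr_ae h1, integral_indicator_one (hV hS)]
  have h4 := hI.measure_inter_preimage_eq_mul S {z} hS (measurableSet_singleton z)
  have h5 : Z ⁻¹' {z} = {ω | Z ω = z} := rfl
  rw [h5] at h4
  rw [measureReal_def, cond_apply hzm, Set.inter_comm, h4, mul_comm (P (V ⁻¹' S)), ← mul_assoc,
    ENNReal.inv_mul_cancel hz (measure_ne_top _ _), one_mul, measureReal_def]

/-- Under Assumptions M1, M3 and M4, the intention-to-treat estimand on
enrollment satisfies `ITT_D = P(D1 = 1, C1 = 1, C0 = 0)`. -/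
theorem itt_D_prob
    {Ω : Type*} [MeasurableSpace Ω] (P : Measure Ω) [IsProbabilityMeasure P]
    (Z C0 C1 D0 D1 : Ω → ℝ)
    (hZm : Measurable Z) (hC0m : Measurable C0) (hC1m : Measurable C1)
    (hD0m : Measurable D0) (hD1m : Measurable D1)
    (hZ01 : ∀ ω, Z ω = 0 ∨ Z ω = 1)
    (hC001 : ∀ ω, C0 ω = 0 ∨ C0 ω = 1)
    (hC101 : ∀ ω, C1 ω = 0 ∨ C1 ω = 1)
    (hD001 : ∀ ω, D0 ω = 0 ∨ D0 ω = 1)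
    (hD101 : ∀ ω, D1 ω = 0 ∨ D1 ω = 1)
    (C D : Ω → ℝ)
    (hC : ∀ ω, C ω = C1 ω * Z ω + C0 ω * (1 - Z ω))
    (hD : ∀ ω, D ω = D1 ω * C ω + D0 ω * (1 - C ω))
    (hZpos : 0 < P {ω | Z ω = 1}) (hZlt : P {ω | Z ω = 1} < 1)
    -- Assumption M1
    (hM1 : ∀ᵐ ω ∂P, D0 ω = 0)
    -- Assumption M3
    (hM3 : IndepFun (fun ω => (D0 ω, D1 ω, C0 ω, C1 ω)) Z P)
    -- Assumption M4
    (hM4 : ∀ᵐ ω ∂P, C1 ω = 1) :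
    (∫ ω, D ω ∂(P[|{ω | Z ω = 1}])) - (∫ ω, D ω ∂(P[|{ω | Z ω = 0}]))
      = (P {ω | D1 ω = 1 ∧ C1 ω = 1 ∧ C0 ω = 0}).toReal := by
  have hVm : Measurable (fun ω => (D0 ω, D1 ω, C0 ω, C1 ω)) := by fun_prop
  have hz0 : P {ω | Z ω = 0} ≠ 0 := by
    intro h
    have h1 : ∀ᵐ ω ∂P, ω ∈ {ω | Z ω = 1} := by
      have h2 : ∀ᵐ ω ∂P, ¬ Z ω = 0 := by
        rw [ae_iff]; simpa using h
      filter_upwards [h2] with ω a using (hZ01 ω).resolve_left a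
    have h3 := prob_compl_eq_zero_iff (μ := P) (s := {ω | Z ω = 1}) (hZm (measurableSet_singleton 1))
    have h4 : P {ω | Z ω = 1} = 1 := h3.1 h1
    exact hZlt.ne h4
  have hS1 : MeasurableSet {v : ℝ × ℝ × ℝ × ℝ | v.2.1 = 1} :=
    measurableSet_eq_fun (by fun_prop) (by fun_prop)
  have hS2 : MeasurableSet {v : ℝ × ℝ × ℝ × ℝ | v.2.2.1 = 1} :=
    measurableSet_eq_fun (by fun_prop) (by fun_prop)
  rw [aux_cond_integral_s6 P _ Z D hVm hZm hM3 1 hZpos.ne' _ hS1,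
    aux_cond_integral_s6 P _ Z D hVm hZm hM3 0 hz0 _ (hS1.inter hS2)]
  · rw [← measureReal_diff (Set.preimage_mono Set.inter_subset_left) (hVm (hS1.inter hS2)),
      ← measureReal_def]
    apply measureReal_congr
    filter_upwards [hM4] with ω h
    apply propext
    change (D1 ω = 1 ∧ ¬ (D1 ω = 1 ∧ C0 ω = 1)) ↔ (D1 ω = 1 ∧ C1 ω = 1 ∧ C0 ω = 0)
    rcases hC001 ω with h' | h' <;> simp [h, h']
  · filter_upwards [hM1, hM4] with ω h1 h4 hz
    rw [hD, hC, h1, h4, hz]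
    rcases hC001 ω with h' | h' <;> rcases hD101 ω with h'' | h'' <;>
      simp [Set.indicator, h', h'']
  · filter_upwards [hM1, hM4] with ω h1 h4 hz
    rw [hD, hC, h1, h4, hz]
    rcases hD101 ω with h'' | h'' <;> simp [Set.indicator, h'']
end

section
/- Charnes–Cooper transformation: let W be a nonempty finite type, a : W → ℝ, T ⊆ W, and S ⊆ (W → ℝ) a set on which the denominator ∑_{w ∈ T} q(w) is strictly positive. Then the set of values of the linear-fractional objective over S equals the set of values of the linear objective over the transformed feasible set: {(∑_w a(w)·q(w)) / (∑_{w ∈ T} q(w)) : q ∈ S} = {∑_w a(w)·y(w) : ∃ γ ≥ 0, ∃ q ∈ S, y = γ • q and ∑_{w ∈ T} y(w) = 1}. -/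
open Finset

/-- Charnes–Cooper transformation: the values of the linear-fractional
objective over `S` coincide with the values of the linear objective over the
transformed feasible set `{y = γ • q : γ ≥ 0, q ∈ S, ∑_{w ∈ T} y w = 1}`. -/
theorem charnes_cooper
    {W : Type*} [Fintype W] [Nonempty W] (a : W → ℝ) (T : Finset W)
    (S : Set (W → ℝ))
    (hpos : ∀ q ∈ S, 0 < ∑ w ∈ T, q w) :
    (fun q : W → ℝ => (∑ w, a w * q w) / (∑ w ∈ T, q w)) '' S
      = (fun y : W → ℝ => ∑ w, a w * y w) ''
          {y : W → ℝ | ∃ γ : ℝ, 0 ≤ γ ∧ ∃ q ∈ S, y = γ • q ∧ ∑ w ∈ T, y w = 1} := by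
  have key : ∀ (γ : ℝ) (q : W → ℝ), ∑ w, a w * (γ • q) w = γ * ∑ w, a w * q w := by
    intro γ q
    rw [Finset.mul_sum]
    refine Finset.sum_congr rfl fun w _ => ?_
    simp only [Pi.smul_apply, smul_eq_mul]
    ring
  have keyT : ∀ (γ : ℝ) (q : W → ℝ), ∑ w ∈ T, (γ • q) w = γ * ∑ w ∈ T, q w := by
    intro γ q
    rw [Finset.mul_sum]
    rfl
  ext v
  constructor
  · rintro ⟨q, hq, rfl⟩
    have h := hpos q hq
    refine ⟨(∑ w ∈ T, q w)⁻¹ • q, ⟨_, (inv_pos.mpr h).le, q, hq, rfl, ?_⟩, ?_⟩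
    · rw [keyT, inv_mul_cancel₀ h.ne']
    · show ∑ w, a w * ((∑ w ∈ T, q w)⁻¹ • q) w = _
      rw [key]
      exact (div_eq_inv_mul _ _).symm
  · rintro ⟨y, ⟨γ, _, q, hq, rfl, h1⟩, rfl⟩
    have h := hpos q hq
    refine ⟨q, hq, ?_⟩
    show _ = ∑ w, a w * (γ • q) w
    rw [keyT] at h1
    rw [key, eq_inv_of_mul_eq_one_left h1, ← div_eq_inv_mul]
end

section
/- Proposition (identified set as a linear program interval): let W be a nonempty finite type, and let 𝐐 = {q : W → ℝ | (∀ w, 0 ≤ q w) ∧ (∑_w q w = 1) ∧ (∀ i ∈ I, ∑_w A i w · q w = b i)} for a finite index set I, A : I → W → ℝ, b : I → ℝ. Let a : W → ℝ, T ⊆ W, and θ(q) = (∑_w a(w)·q(w)) / (∑_{w ∈ T} q(w)). If 𝐐 is nonempty and ∑_{w ∈ T} q(w) > 0 for every q ∈ 𝐐, then the identified set Θ = {θ₀ ∈ ℝ : ∃ q ∈ 𝐐, θ(q) = θ₀} equals the closed interval [θ_l, θ_u], where θ_l and θ_u are the (attained) minimum and maximum of θ over 𝐐. -/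
open Finset

/-- Identified set as a linear program interval: if the set `𝐐` of pmf's on a
finite set `W` satisfying finitely many affine equality constraints is
nonempty and the denominator `∑_{w ∈ T} q w` of the linear-fractional
parameter `θ` is strictly positive on `𝐐`, then the identified set
`Θ = {θ₀ : ∃ q ∈ 𝐐, θ q = θ₀}` is the closed interval `[θ_l, θ_u]` whose
endpoints are the attained minimum and maximum of `θ` over `𝐐`. -/
theorem identified_set_is_interval
    {W : Type*} [Fintype W] [Nonempty W]
    {ι : Type*} [Fintype ι] (A : ι → W → ℝ) (b : ι → ℝ)
    (a : W → ℝ) (T : Finset W)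
    (Q : Set (W → ℝ))
    (hQ : Q = {q : W → ℝ | (∀ w, 0 ≤ q w) ∧ (∑ w, q w = 1) ∧
        ∀ i, ∑ w, A i w * q w = b i})
    (hne : Q.Nonempty)
    (hpos : ∀ q ∈ Q, 0 < ∑ w ∈ T, q w) :
    ∃ ql ∈ Q, ∃ qu ∈ Q,
      (∀ q ∈ Q,
        (∑ w, a w * ql w) / (∑ w ∈ T, ql w) ≤ (∑ w, a w * q w) / (∑ w ∈ T, q w) ∧
        (∑ w, a w * q w) / (∑ w ∈ T, q w) ≤ (∑ w, a w * qu w) / (∑ w ∈ T, qu w)) ∧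
      {θ₀ : ℝ | ∃ q ∈ Q, (∑ w, a w * q w) / (∑ w ∈ T, q w) = θ₀}
        = Set.Icc ((∑ w, a w * ql w) / (∑ w ∈ T, ql w))
            ((∑ w, a w * qu w) / (∑ w ∈ T, qu w)) := by
  have hQ' : Q = stdSimplex ℝ W ∩ {q : W → ℝ | ∀ i, ∑ w, A i w * q w = b i} := by
    rw [hQ]
    ext q
    simp [stdSimplex, and_assoc]
  have hclosed : IsClosed {q : W → ℝ | ∀ i, ∑ w, A i w * q w = b i} := by
    rw [Set.setOf_forall]
    exact isClosed_iInter fun i => isClosed_eq (by fun_prop) continuous_const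
  have hcomp : IsCompact Q := by
    rw [hQ']
    exact (isCompact_stdSimplex ℝ W).inter_right hclosed
  have hconv : Convex ℝ Q := by
    rw [hQ']
    refine (convex_stdSimplex ℝ W).inter ?_
    intro x hx y hy s t _ _ hst i
    have h1 : ∑ w, A i w * (s • x + t • y) w
        = s * ∑ w, A i w * x w + t * ∑ w, A i w * y w := by
      rw [Finset.mul_sum, Finset.mul_sum, ← Finset.sum_add_distrib]
      refine Finset.sum_congr rfl fun w _ => ?_
      simp only [Pi.add_apply, Pi.smul_apply, smul_eq_mul]
      ring
    rw [h1, hx i, hy i, ← add_mul, hst, one_mul]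
  have hcont : ContinuousOn
      (fun q : W → ℝ => (∑ w, a w * q w) / (∑ w ∈ T, q w)) Q := by
    refine ContinuousOn.div (Continuous.continuousOn (by fun_prop))
      (Continuous.continuousOn (by fun_prop)) fun q hq => (hpos q hq).ne'
  obtain ⟨ql, hql, hl⟩ := hcomp.exists_isMinOn hne hcont
  obtain ⟨qu, hqu, hu⟩ := hcomp.exists_isMaxOn hne hcont
  refine ⟨ql, hql, qu, hqu, fun q hq => ⟨hl hq, hu hq⟩, ?_⟩
  apply Set.Subset.antisymm
  · rintro _ ⟨q, hq, rfl⟩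
    exact ⟨hl hq, hu hq⟩
  · exact hconv.isPreconnected.intermediate_value hql hqu hcont
end
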